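/- Let g : (0, ∞) → [0, ∞) be measurable, integrable on (0, 1), and satisfy g(x) = Σ_{k≥1} Σ_{a odd, 0 < a < 2^k} (1/(a + 2^k x))² g(1/(a + 2^k x)) for all x > 0 (g is a fixed point of Vallée's operator V₂). Let G(x) = ∫₀ˣ g(t) dt. Then for all x > 0: G(x) = Σ_{k≥1} 2^{−k} Σ_{a odd, 0 < a < 2^k} ( G(1/a) − G(1/(a + 2^k x)) ). -/

import Mathlib

/-- Vallée's operator
`V₂[g](x) = Σ_{k≥1} Σ_{a odd, 0 < a < 2^k} (1/(a+2^k x))² · g(1/(a+2^k x))`. -/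
noncomputable def opV2 (g : ℝ → ℝ) (x : ℝ) : ℝ :=
  ∑' k : ℕ, ∑' a : ℕ,
    if Odd a ∧ 0 < a ∧ a < 2 ^ (k + 1) then
      (1 / (a + 2 ^ (k + 1) * x)) ^ 2 * g (1 / (a + 2 ^ (k + 1) * x))
    else 0

open MeasureTheory Set

theorem sum_range_dyadic_truncated_le {C : ℝ} (hC : 0 ≤ C) (n : ℕ) {z : ℝ} (hz : 0 ≤ z) :
    (∑ k ∈ Finset.range n, if z / 2 ^ k < C then z / 2 ^ k else 0) ≤ 2 * z ∧
      (∑ k ∈ Finset.range n, if z / 2 ^ k < C then z / 2 ^ k else 0) ≤ 2 * C := by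
  induction n generalizing z with
  | zero => simp [hz, hC]
  | succ n ih =>
    obtain ⟨h₁, h₂⟩ := ih (z := z / 2) (by positivity)
    have hshift : ∀ k : ℕ, z / 2 ^ (k + 1) = z / 2 / 2 ^ k := fun k => by
      rw [pow_succ', div_div]
    rw [Finset.sum_range_succ']
    simp only [hshift, pow_zero, div_one]
    split_ifs with h <;> constructor <;> linarith

theorem card_le_one_div_of_forall_le_one_div {u : ℝ} (hu : 0 < u) (s : Finset ℕ)
    (hs : ∀ a ∈ s, 0 < a ∧ u ≤ 1 / (a : ℝ)) : (s.card : ℝ) ≤ 1 / u := by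
  have hsub : s ⊆ Finset.Ioc 0 ⌊1 / u⌋₊ := fun a ha => by
    obtain ⟨h0, h1⟩ := hs a ha
    have h0' : (0 : ℝ) < a := by exact_mod_cast h0
    exact Finset.mem_Ioc.2 ⟨h0, Nat.le_floor ((le_one_div hu h0').1 h1)⟩
  calc (s.card : ℝ) ≤ ((Finset.Ioc 0 ⌊1 / u⌋₊).card : ℝ) := by
        exact_mod_cast Finset.card_le_card hsub
    _ ≤ 1 / u := by simpa using Nat.floor_le (a := 1 / u) (by positivity)

theorem image_one_div_affine_Icc {a b x : ℝ} (ha : 0 < a) (hb : 0 < b) (hx : 0 < x) :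
    (fun t => 1 / (a + b * t)) '' Icc 0 x = Icc (1 / (a + b * x)) (1 / a) := by
  ext u
  constructor
  · rintro ⟨t, ⟨h0, h1⟩, rfl⟩
    have : 0 ≤ b * t := by positivity
    have : b * t ≤ b * x := by gcongr
    exact ⟨one_div_le_one_div_of_le (by linarith) (by linarith),
      one_div_le_one_div_of_le ha (by linarith)⟩
  · rintro ⟨h0, h1⟩
    have hbx : 0 < a + b * x := by positivity
    have hu : 0 < u := lt_of_lt_of_le (by positivity) h0
    have h0' := (one_div_le hbx hu).1 h0
    have h1' := (le_one_div hu ha).1 h1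
    refine ⟨(1 / u - a) / b, ⟨div_nonneg (by linarith) hb.le, ?_⟩, ?_⟩
    · rw [div_le_iff₀ hb]; linarith
    · have : a + b * ((1 / u - a) / b) = 1 / u := by field_simp; ring
      simp only [this, one_div_one_div]

section ChangeOfVariables

variable {a b x : ℝ}

theorem hasDerivWithinAt_one_div_affine (ha : 0 < a) (hb : 0 < b) :
    ∀ t ∈ Icc 0 x,
      HasDerivWithinAt (fun t => 1 / (a + b * t)) (-b / (a + b * t) ^ 2) (Icc 0 x) t := by
  intro t ht
  have hne : a + b * t ≠ 0 := by have := mul_nonneg hb.le ht.1; linarith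
  have h : HasDerivAt (fun t => a + b * t) b t := by
    simpa using ((hasDerivAt_id t).const_mul b).const_add a
  simp only [one_div]
  exact (h.fun_inv hne).hasDerivWithinAt

theorem injOn_one_div_affine (hb : 0 < b) :
    InjOn (fun t => 1 / (a + b * t)) (Icc 0 x) := by
  intro s _ t _ h
  simpa [hb.ne'] using h

theorem abs_deriv_one_div_affine (hb : 0 < b) (g : ℝ → ℝ) (t : ℝ) :
    |-b / (a + b * t) ^ 2| • g (1 / (a + b * t)) =
      b * ((1 / (a + b * t)) ^ 2 * g (1 / (a + b * t))) := by
  rw [abs_div, abs_neg, abs_of_pos hb, abs_of_nonneg (sq_nonneg _), smul_eq_mul, one_div_pow]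
  ring

theorem integrableOn_comp_one_div_affine (ha : 0 < a) (hb : 0 < b) (hx : 0 < x) {g : ℝ → ℝ}
    (hg : IntegrableOn g (Icc (1 / (a + b * x)) (1 / a))) :
    IntegrableOn (fun t => (1 / (a + b * t)) ^ 2 * g (1 / (a + b * t))) (Icc 0 x) := by
  rw [← image_one_div_affine_Icc ha hb hx, integrableOn_image_iff_integrableOn_abs_deriv_smul
    measurableSet_Icc (hasDerivWithinAt_one_div_affine ha hb) (injOn_one_div_affine hb)] at hg
  simp only [abs_deriv_one_div_affine hb] at hg
  simpa only [IntegrableOn, inv_mul_cancel_left₀ hb.ne'] using hg.const_mul b⁻¹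

theorem setIntegral_comp_one_div_affine (ha : 0 < a) (hb : 0 < b) (hx : 0 < x) (g : ℝ → ℝ) :
    ∫ t in Icc 0 x, (1 / (a + b * t)) ^ 2 * g (1 / (a + b * t)) =
      b⁻¹ * ∫ u in Icc (1 / (a + b * x)) (1 / a), g u := by
  rw [← image_one_div_affine_Icc ha hb hx, integral_image_eq_integral_abs_deriv_smul
    measurableSet_Icc (hasDerivWithinAt_one_div_affine ha hb) (injOn_one_div_affine hb)]
  simp only [abs_deriv_one_div_affine hb]
  rw [integral_const_mul, inv_mul_cancel_left₀ hb.ne']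

end ChangeOfVariables

/-- The odd natural numbers below `2 ^ (k + 1)`. -/
def oddBelow (k : ℕ) : Finset ℕ := (Finset.range (2 ^ (k + 1))).filter Odd

theorem mem_oddBelow {k a : ℕ} : a ∈ oddBelow k ↔ Odd a ∧ 0 < a ∧ a < 2 ^ (k + 1) := by
  simp only [oddBelow, Finset.mem_filter, Finset.mem_range]
  exact ⟨fun h => ⟨h.2, h.2.pos, h.1⟩, fun h => ⟨h.2.2, h.1⟩⟩

theorem tsum_ite_odd_eq_sum (k : ℕ) (f : ℕ → ℝ) :
    (∑' a : ℕ, if Odd a ∧ 0 < a ∧ a < 2 ^ (k + 1) then f a else 0) =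
      ∑ a ∈ oddBelow k, f a := by
  simp only [← mem_oddBelow]
  rw [tsum_eq_sum (s := oddBelow k) (fun a ha => if_neg ha)]
  exact Finset.sum_congr rfl fun a ha => if_pos ha

theorem sum_oddBelow_indicator_le {x u : ℝ} (hx : 0 < x) (hu : 0 < u) (k : ℕ) :
    (1 / 2 : ℝ) ^ (k + 1) * ∑ a ∈ oddBelow k,
        (Icc (1 / (a + 2 ^ (k + 1) * x)) (1 / (a : ℝ))).indicator (1 : ℝ → ℝ) u ≤
      if 1 / u / 2 ^ k < 2 * (1 + x) then 1 / u / 2 ^ k else 0 := by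
  classical
  set P : ℕ → Prop := fun a => u ∈ Icc (1 / (a + 2 ^ (k + 1) * x)) (1 / (a : ℝ)) with hP
  have hsum : ∑ a ∈ oddBelow k,
      (Icc (1 / (a + 2 ^ (k + 1) * x)) (1 / (a : ℝ))).indicator (1 : ℝ → ℝ) u =
      (((oddBelow k).filter P).card : ℝ) := by
    simp [Set.indicator_apply, hP]
  rw [hsum]
  split_ifs with h
  · have hcard := card_le_one_div_of_forall_le_one_div hu ((oddBelow k).filter P) fun a ha => by
      obtain ⟨h₁, h₂⟩ := Finset.mem_filter.1 ha
      exact ⟨(mem_oddBelow.1 h₁).2.1, h₂.2⟩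
    calc (1 / 2 : ℝ) ^ (k + 1) * (((oddBelow k).filter P).card : ℝ)
        ≤ (1 / 2 : ℝ) ^ k * (1 / u) := by
          gcongr ?_ * ?_
          exact pow_le_pow_of_le_one (by norm_num) (by norm_num) (Nat.le_succ k)
      _ = 1 / u / 2 ^ k := by rw [one_div_pow]; ring
  · have hempty : (oddBelow k).filter P = ∅ := by
      refine Finset.filter_eq_empty_iff.2 fun a ha hPa => h ?_
      obtain ⟨-, h0, hlt⟩ := mem_oddBelow.1 ha
      have hlt' : (a : ℝ) < 2 ^ (k + 1) := by exact_mod_cast hlt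
      have hle := (one_div_le (by positivity) hu).1 hPa.1
      rw [div_lt_iff₀ (by positivity)]
      calc 1 / u ≤ a + 2 ^ (k + 1) * x := hle
        _ < 2 ^ (k + 1) + 2 ^ (k + 1) * x := by gcongr
        _ = 2 * (1 + x) * 2 ^ k := by ring
    simp [hempty]

theorem Icc_one_div_subset_Ioc {a : ℕ} (ha : 0 < a) {b x : ℝ} (hb : 0 < b) (hx : 0 < x) :
    Icc (1 / (a + b * x)) (1 / (a : ℝ)) ⊆ Ioc 0 1 := fun u hu => by
  have ha' : (1 : ℝ) ≤ a := by exact_mod_cast ha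
  refine ⟨lt_of_lt_of_le (by positivity) hu.1, hu.2.trans ?_⟩
  simpa using one_div_le_one_div_of_le one_pos ha'

theorem summable_dyadic_setIntegral {g : ℝ → ℝ} (hnonneg : ∀ u, 0 < u → 0 ≤ g u)
    (hint : IntegrableOn g (Ioc 0 1)) {x : ℝ} (hx : 0 < x) :
    Summable fun k : ℕ => (1 / 2 : ℝ) ^ (k + 1) * ∑ a ∈ oddBelow k,
      ∫ u in Icc (1 / (a + 2 ^ (k + 1) * x)) (1 / (a : ℝ)), g u := by
  set I : ℕ → ℕ → Set ℝ := fun k a => Icc (1 / (a + 2 ^ (k + 1) * x)) (1 / (a : ℝ))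
  have hsub : ∀ k, ∀ a ∈ oddBelow k, I k a ⊆ Ioc 0 1 := fun k a ha =>
    Icc_one_div_subset_Ioc (mem_oddBelow.1 ha).2.1 (by positivity) hx
  set F : ℕ → ℝ → ℝ := fun k u =>
    (1 / 2 : ℝ) ^ (k + 1) * ∑ a ∈ oddBelow k, (I k a).indicator g u with hF
  have hFint : ∀ k, IntegrableOn (F k) (Ioc 0 1) := fun k =>
    (integrable_finsetSum _ fun a _ => hint.indicator measurableSet_Icc).const_mul _
  have hterm : ∀ k, (1 / 2 : ℝ) ^ (k + 1) * ∑ a ∈ oddBelow k, ∫ u in I k a, g u =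
      ∫ u in Ioc 0 1, F k u := fun k => by
    rw [integral_const_mul, integral_finsetSum _ fun a _ => hint.indicator measurableSet_Icc]
    congr 1
    refine Finset.sum_congr rfl fun a ha => ?_
    rw [setIntegral_indicator measurableSet_Icc, inter_eq_self_of_subset_right (hsub k a ha)]
  refine summable_of_sum_range_le (c := ∫ u in Ioc 0 1, 2 * (2 * (1 + x)) * g u)
    (fun k => ?_) (fun n => ?_)
  · refine mul_nonneg (by positivity) (Finset.sum_nonneg fun a ha => ?_)
    exact setIntegral_nonneg measurableSet_Icc fun u hu => hnonneg u (hsub k a ha hu).1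
  · rw [Finset.sum_congr rfl fun k _ => hterm k, ← integral_finsetSum _ fun k _ => hFint k]
    refine setIntegral_mono_on (integrable_finsetSum _ fun k _ => hFint k) (hint.const_mul _)
      measurableSet_Ioc fun u hu => ?_
    have hFu : ∀ k, F k u = (1 / 2 : ℝ) ^ (k + 1) *
        (∑ a ∈ oddBelow k, (I k a).indicator (1 : ℝ → ℝ) u) * g u := fun k => by
      rw [mul_assoc, Finset.sum_mul]
      simp only [hF, Set.indicator_apply, Pi.one_apply, ite_mul, one_mul, zero_mul]
    simp only [hFu]
    rw [← Finset.sum_mul]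
    refine mul_le_mul_of_nonneg_right ?_ (hnonneg u hu.1)
    exact (Finset.sum_le_sum fun k _ => sum_oddBelow_indicator_le hx hu.1 k).trans
      (sum_range_dyadic_truncated_le (by positivity) n (one_div_pos.2 hu.1).le).2

/-- If `g ≥ 0` on `(0,∞)` is measurable, integrable on `(0,1)`, and a fixed
point of Vallée's operator `V₂`, then its distribution `G(x) = ∫₀ˣ g` satisfies
`G(x) = Σ_{k≥1} 2^{−k} Σ_{a odd, 0<a<2^k} (G(1/a) − G(1/(a+2^k x)))` for `x > 0`. -/
theorem G_functional_equation (g : ℝ → ℝ) (hmeas : Measurable g)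
    (hnonneg : ∀ x : ℝ, 0 < x → 0 ≤ g x)
    (hint : MeasureTheory.IntegrableOn g (Set.Ioo (0 : ℝ) 1))
    (hfix : ∀ x : ℝ, 0 < x → g x = opV2 g x)
    (G : ℝ → ℝ) (hG : ∀ x, G x = ∫ t in (0 : ℝ)..x, g t) :
    ∀ x : ℝ, 0 < x →
      G x = ∑' k : ℕ, (1 / 2 : ℝ) ^ (k + 1) *
        ∑' a : ℕ,
          if Odd a ∧ 0 < a ∧ a < 2 ^ (k + 1) then
            G (1 / a) - G (1 / (a + 2 ^ (k + 1) * x))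
          else 0 := by
  intro x hx
  have hint' : IntegrableOn g (Ioc 0 1) := (integrableOn_Ioc_iff_integrableOn_Ioo).2 hint
  have hsub : ∀ k, ∀ a ∈ oddBelow k,
      Icc (1 / (a + 2 ^ (k + 1) * x)) (1 / (a : ℝ)) ⊆ Ioc 0 1 := fun k a ha =>
    Icc_one_div_subset_Ioc (mem_oddBelow.1 ha).2.1 (by positivity) hx
  have hpos : ∀ k, ∀ a ∈ oddBelow k, (0 : ℝ) < a := fun k a ha => by
    exact_mod_cast (mem_oddBelow.1 ha).2.1
  have hdiff : ∀ k, ∀ a ∈ oddBelow k, G (1 / a) - G (1 / (a + 2 ^ (k + 1) * x)) =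
      ∫ u in Icc (1 / (a + 2 ^ (k + 1) * x)) (1 / (a : ℝ)), g u := fun k a ha => by
    have ha' := hpos k a ha
    have hle : 1 / (a + 2 ^ (k + 1) * x) ≤ 1 / (a : ℝ) :=
      one_div_le_one_div_of_le ha' (by linarith [show 0 < 2 ^ (k + 1) * x by positivity])
    have hii : ∀ u ∈ Ioc (0 : ℝ) 1, IntervalIntegrable g volume 0 u := fun u hu =>
      (intervalIntegrable_iff_integrableOn_Ioc_of_le hu.1.le).2
        (hint'.mono_set (Ioc_subset_Ioc_right hu.2))
    rw [hG, hG, intervalIntegral.integral_interval_sub_left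
      (hii _ (hsub k a ha (right_mem_Icc.2 hle))) (hii _ (hsub k a ha (left_mem_Icc.2 hle))),
      intervalIntegral.integral_of_le hle, integral_Icc_eq_integral_Ioc]
  set F : ℕ → ℝ → ℝ := fun k t => ∑ a ∈ oddBelow k,
    (1 / (a + 2 ^ (k + 1) * t)) ^ 2 * g (1 / (a + 2 ^ (k + 1) * t)) with hF
  have hFint_summand : ∀ k, ∀ a ∈ oddBelow k, IntegrableOn (fun t =>
      (1 / (a + 2 ^ (k + 1) * t)) ^ 2 * g (1 / (a + 2 ^ (k + 1) * t))) (Icc 0 x) :=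
    fun k a ha => integrableOn_comp_one_div_affine (hpos k a ha) (by positivity) hx
      (hint'.mono_set (hsub k a ha))
  have hFint : ∀ k, IntegrableOn (F k) (Icc 0 x) := fun k =>
    integrable_finsetSum _ (hFint_summand k)
  have hFval : ∀ k, ∫ t in Icc 0 x, F k t = (1 / 2 : ℝ) ^ (k + 1) * ∑ a ∈ oddBelow k,
      ∫ u in Icc (1 / (a + 2 ^ (k + 1) * x)) (1 / (a : ℝ)), g u := fun k => by
    rw [integral_finsetSum _ (hFint_summand k), Finset.mul_sum]
    refine Finset.sum_congr rfl fun a ha => ?_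
    rw [setIntegral_comp_one_div_affine (hpos k a ha) (by positivity) hx, one_div_pow,
      one_div (2 ^ (k + 1) : ℝ)]
  have hFnorm : ∀ k, ∫ t in Icc 0 x, ‖F k t‖ = ∫ t in Icc 0 x, F k t := fun k =>
    setIntegral_congr_fun measurableSet_Icc fun t ht => Real.norm_of_nonneg <|
      Finset.sum_nonneg fun a ha => by
        have ha := hpos k a ha
        have ht := ht.1
        exact mul_nonneg (sq_nonneg _) (hnonneg _ (by positivity))
  have hsummable : Summable fun k => ∫ t in Icc 0 x, ‖F k t‖ := by
    simp only [hFnorm, hFval]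
    exact summable_dyadic_setIntegral hnonneg hint' hx
  calc G x = ∫ t in Ioc 0 x, ∑' k, F k t := by
        rw [hG, intervalIntegral.integral_of_le hx.le]
        refine setIntegral_congr_fun measurableSet_Ioc fun t ht => ?_
        simp only [hfix t ht.1, opV2, tsum_ite_odd_eq_sum, hF]
    _ = ∑' k, ∫ t in Icc 0 x, F k t := by
        rw [← integral_Icc_eq_integral_Ioc, integral_tsum_of_summable_integral_norm hFint hsummable]
    _ = _ := by
        refine tsum_congr fun k => ?_
        rw [hFval, tsum_ite_odd_eq_sum, Finset.sum_congr rfl (hdiff k)]
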